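/- Let f : ℝ → ℝ be continuous with f(0) = f(s₀) = f(1) = 0 for some 0 < s₀ < 1, f < 0 on (0,s₀) ∪ (1,∞), f > 0 on (-∞,0) ∪ (s₀,1). Let c ∈ ℝ and let v : ℝ → ℝ be a C² solution of v'' + c·v' + f(v) = 0 on ℝ with v(z) → 0 as z → -∞ and v(z) → 1 as z → +∞. Then 0 ≤ v(z) ≤ 1 for all z ∈ ℝ. -/

import Mathlib

open Filter Set

lemma aux_max (w : ℝ → ℝ) (a b M : ℝ) (hw : Continuous w)
    (hbot : Tendsto w atBot (nhds a)) (htop : Tendsto w atTop (nhds b))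
    (ha : a ≤ M) (hb : b ≤ M) (z : ℝ) (hz : M < w z) :
    ∃ m, M < w m ∧ deriv w m = 0 ∧ deriv (deriv w) m ≤ 0 := by
  have h1 : ∀ᶠ x in cocompact ℝ, w x ≤ w z := by
    rw [cocompact_eq_atBot_atTop, eventually_sup]
    exact ⟨hbot.eventually_le_const (by linarith), htop.eventually_le_const (by linarith)⟩
  obtain ⟨m, hm⟩ := hw.exists_forall_ge' z h1
  have hmax : IsLocalMax w m := Eventually.of_forall hm
  refine ⟨m, lt_of_lt_of_le hz (hm z), hmax.deriv_eq_zero, ?_⟩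
  by_contra! hlt
  have hmin := isLocalMin_of_deriv_deriv_pos hlt hmax.deriv_eq_zero hw.continuousAt
  have hc : w =ᶠ[nhds m] fun _ => w m := by
    filter_upwards [hmin] with x hx
    exact le_antisymm (hm x) hx
  have := hc.deriv.deriv_eq
  simp at this
  linarith

theorem stmt_0 (f : ℝ → ℝ) (s₀ c : ℝ) (v : ℝ → ℝ)
    (hf : Continuous f) (hs₀ : 0 < s₀) (hs₀1 : s₀ < 1)
    (hf0 : f 0 = 0) (hfs₀ : f s₀ = 0) (hf1 : f 1 = 0)
    (hneg : ∀ s, (s ∈ Ioo 0 s₀ ∨ s ∈ Ioi 1) → f s < 0)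
    (hpos : ∀ s, (s ∈ Iio 0 ∨ s ∈ Ioo s₀ 1) → 0 < f s)
    (hv : ContDiff ℝ 2 v)
    (hode : ∀ z, deriv (deriv v) z + c * deriv v z + f (v z) = 0)
    (hbot : Tendsto v atBot (nhds 0)) (htop : Tendsto v atTop (nhds 1)) :
    ∀ z, 0 ≤ v z ∧ v z ≤ 1 := by
  intro z
  constructor
  · by_contra! h
    obtain ⟨m, h1, h2, h3⟩ := aux_max (fun x => - v x) (-0) (-1) 0 hv.continuous.neg
      hbot.neg htop.neg (by simp) (by simp) z (by linarith)
    have e : deriv (fun x => - v x) = fun x => - deriv v x := by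
      funext x; exact deriv.fun_neg
    rw [e] at h2 h3
    rw [deriv.fun_neg] at h3
    have h4 := hode m
    have h5 := hpos (v m) (Or.inl (by simp only [mem_Iio]; linarith))
    have h6 : deriv v m = 0 := by simpa using h2
    rw [h6] at h4
    linarith
  · by_contra! h
    obtain ⟨m, h1, h2, h3⟩ := aux_max v 0 1 1 hv.continuous
      hbot htop (by simp) le_rfl z h
    have h4 := hode m
    have h5 := hneg (v m) (Or.inr h1)
    rw [h2] at h4
    linarith
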